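/- Let F be a finite field of odd characteristic with q elements and let t : V × V → T be an alternating F-tensor such that Pf(t) = 0 defines an elliptic curve in P²_F, i.e. the matrix of linear forms B representing t satisfies det(B) = f² for a smooth homogeneous cubic f ∈ F[y₁,y₂,y₃]. Then dim_F V = 6, dim_F T = 3, and |𝒯(t)| ∈ {0, 1, 2, q+1}. -/

import Mathlib

open Matrix

/-- The tensor `(u, v) ↦ (uᵀ B₁ v, …, uᵀ B_d v)` given coefficient matrices. -/
def matTensor {K : Type*} [CommRing K] {ι : Type*} [Fintype ι] {d : ℕ}
    (B : Fin d → Matrix ι ι K) (u v : ι → K) : Fin d → K :=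
  fun k => u ⬝ᵥ (B k).mulVec v

/-- The matrix of linear forms `B = B₁y₁ + ⋯ + B_d y_d` over `K[y₁,…,y_d]`. -/
noncomputable def polyMat {K : Type*} [CommRing K] {ι : Type*} {d : ℕ}
    (B : Fin d → Matrix ι ι K) : Matrix ι ι (MvPolynomial (Fin d) K) :=
  Matrix.of fun i j => ∑ k, MvPolynomial.C (B k i j) * MvPolynomial.X k

/-- A homogeneous cubic `f ∈ K[y₁,y₂,y₃]` is smooth if `f` and its three partial derivatives
have no common nontrivial zero over an algebraic closure of `K`. -/
def SmoothCubic {K : Type*} [Field K] (f : MvPolynomial (Fin 3) K) : Prop :=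
  f.IsHomogeneous 3 ∧
    ∀ v : Fin 3 → AlgebraicClosure K, v ≠ 0 →
      ¬ ((MvPolynomial.aeval v) f = 0 ∧ ∀ k, (MvPolynomial.aeval v) (MvPolynomial.pderiv k f) = 0)

/-- Vectors can be picked one after the other from subspaces of sufficiently large dimension so
as to be linearly independent. -/
theorem exists_linearIndependent_mem {k V : Type*} [Field k] [AddCommGroup V] [Module k V]
    [FiniteDimensional k V] (n : ℕ) (N : Fin n → Submodule k V)
    (hN : ∀ i : Fin n, (i : ℕ) < Module.finrank k (N i)) :
    ∃ v : Fin n → V, LinearIndependent k v ∧ ∀ i, v i ∈ N i := by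
  induction n with
  | zero => exact ⟨Fin.elim0, linearIndependent_empty_type, fun i => i.elim0⟩
  | succ n ih =>
    obtain ⟨v, hv, hm⟩ := ih (fun i => N i.castSucc) (fun i => by simpa using hN i.castSucc)
    have hlt : ¬ N (Fin.last n) ≤ Submodule.span k (Set.range v) := by
      intro hle
      have h1 := Submodule.finrank_mono hle
      rw [finrank_span_eq_card hv, Fintype.card_fin] at h1
      have h2 := hN (Fin.last n)
      simp only [Fin.val_last] at h2
      omega
    obtain ⟨x, hx, hxs⟩ := SetLike.not_le_iff_exists.mp hlt
    refine ⟨Fin.snoc v x, linearIndependent_finSnoc.mpr ⟨hv, hxs⟩, fun i => ?_⟩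
    refine Fin.lastCases ?_ (fun j => ?_) i
    · simpa using hx
    · simpa using hm j

/-- A line and a conic (given as the determinant of a `2 × 2` matrix of linear forms) meet in the
projective plane over an algebraically closed field. -/
theorem exists_common_zero {L : Type*} [Field L] [IsAlgClosed L] (m a b c d : Fin 3 → L) :
    ∃ v : Fin 3 → L, v ≠ 0 ∧ m ⬝ᵥ v = 0 ∧ (a ⬝ᵥ v) * (d ⬝ᵥ v) - (b ⬝ᵥ v) * (c ⬝ᵥ v) = 0 := by
  let K := LinearMap.ker (dotProductBilin L L m)
  have hK : 2 ≤ Module.finrank L K := by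
    have h1 := LinearMap.finrank_range_add_finrank_ker (dotProductBilin L L m)
    have h2 := Submodule.finrank_le (LinearMap.range (dotProductBilin L L m))
    simp at h1 h2
    change _ + Module.finrank L K = 3 at h1
    omega
  obtain ⟨v, hv, hm⟩ := exists_linearIndependent_mem 2 (fun _ => K) (fun i => i.isLt.trans_le hK)
  have hx : m ⬝ᵥ v 0 = 0 := hm 0
  have hy : m ⬝ᵥ v 1 = 0 := hm 1
  by_cases h0 : (a ⬝ᵥ v 0) * (d ⬝ᵥ v 0) - (b ⬝ᵥ v 0) * (c ⬝ᵥ v 0) = 0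
  · exact ⟨v 0, hv.ne_zero 0, hx, h0⟩
  · obtain ⟨s, hs⟩ := IsAlgClosed.exists_root
      (Polynomial.C ((a ⬝ᵥ v 0) * (d ⬝ᵥ v 0) - (b ⬝ᵥ v 0) * (c ⬝ᵥ v 0)) * Polynomial.X ^ 2 +
        Polynomial.C ((a ⬝ᵥ v 0) * (d ⬝ᵥ v 1) + (a ⬝ᵥ v 1) * (d ⬝ᵥ v 0)
          - (b ⬝ᵥ v 0) * (c ⬝ᵥ v 1) - (b ⬝ᵥ v 1) * (c ⬝ᵥ v 0)) * Polynomial.X +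
        Polynomial.C ((a ⬝ᵥ v 1) * (d ⬝ᵥ v 1) - (b ⬝ᵥ v 1) * (c ⬝ᵥ v 1)))
      (by rw [Polynomial.degree_quadratic h0]; decide)
    refine ⟨s • v 0 + v 1, fun h => ?_, ?_, ?_⟩
    · have := LinearIndependent.pair_iff.mp
        (show LinearIndependent L ![v 0, v 1] by
          have h2 : ![v 0, v 1] = v := by ext i; fin_cases i <;> rfl
          rwa [h2])
        s 1 (by simpa using h)
      exact one_ne_zero this.2
    · simp [dotProduct_add, dotProduct_smul, hx, hy]
    · simp only [Polynomial.IsRoot, Polynomial.eval_add, Polynomial.eval_mul, Polynomial.eval_C,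
        Polynomial.eval_pow, Polynomial.eval_X] at hs
      simp only [dotProduct_add, dotProduct_smul, smul_eq_mul]
      linear_combination hs

theorem det_fromBlocks_zero_neg_transpose {R n : Type*} [CommRing R] [Fintype n] [DecidableEq n]
    (M C : Matrix n n R) : (fromBlocks 0 M (-Mᵀ) C).det = M.det ^ 2 := by
  have h : fromBlocks 0 M (-Mᵀ) C = fromBlocks (-M) 0 (-C) (-Mᵀ) *
      (fromBlocks 1 (-1) 0 1 * fromBlocks 1 0 1 1 * fromBlocks 1 (-1) 0 1) := by
    simp [fromBlocks_multiply]
  rw [h]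
  simp only [det_mul, det_fromBlocks_zero₁₂, det_fromBlocks_zero₂₁, det_one, det_neg,
    det_transpose]
  have h2 : ((-1 : R) ^ Fintype.card n) ^ 2 = 1 := by rw [← pow_mul, mul_comm, pow_mul]; simp
  linear_combination M.det ^ 2 * h2

/-- `f` has no singular point with coordinates in `L`. -/
def NonsingularOver {k : Type*} (L : Type*) [Field k] [Field L] [Algebra k L]
    (f : MvPolynomial (Fin 3) k) : Prop :=
  ∀ v : Fin 3 → L, v ≠ 0 →
    ¬ (MvPolynomial.aeval v f = 0 ∧ ∀ i, MvPolynomial.aeval v (MvPolynomial.pderiv i f) = 0)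

theorem polyMat_eq_sum {R ι : Type*} [CommRing R] {d : ℕ} (B : Fin d → Matrix ι ι R) :
    polyMat B = ∑ l, (MvPolynomial.X l : MvPolynomial (Fin d) R) • (B l).map MvPolynomial.C := by
  ext1 i j
  simp [polyMat, Matrix.sum_apply, mul_comm]

/-- The Gram matrix of a tensor in another basis has the same determinant up to a square. -/
theorem det_polyMat_gram {k ι κ : Type*} [Field k] [Fintype ι] [DecidableEq ι] [Fintype κ]
    [DecidableEq κ] {d : ℕ} (B : Fin d → Matrix ι ι k) (hcard : Fintype.card κ = Fintype.card ι)
    (v : κ → ι → k) (hv : LinearIndependent k v) :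
    ∃ c : k, c ≠ 0 ∧ (polyMat fun l => of fun i j => matTensor B (v i) (v j) l).det =
      MvPolynomial.C c ^ 2 * (polyMat B).det := by
  let e : κ ≃ ι := Fintype.equivOfCardEq hcard
  let Q : Matrix κ ι k := of v
  let P : Matrix κ κ k := Q.submatrix id e
  have hP : IsUnit P := by
    rw [← linearIndependent_rows_iff_isUnit]
    exact hv.map' (LinearMap.funLeft k k e) (LinearMap.ker_eq_bot.mpr
      (LinearMap.funLeft_injective_of_surjective k k e e.surjective))
  refine ⟨P.det, ((isUnit_iff_isUnit_det P).mp hP).ne_zero, ?_⟩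
  let C' := (MvPolynomial.C : k →+* MvPolynomial (Fin d) k)
  have h : (polyMat fun l => of fun i j => matTensor B (v i) (v j) l) =
      C'.mapMatrix P * (polyMat B).submatrix e e * C'.mapMatrix Pᵀ := by
    have h1 : (polyMat fun l => of fun i j => matTensor B (v i) (v j) l) =
        Q.map C' * polyMat B * Qᵀ.map C' := by
      have h2 : (fun l => of fun i j => matTensor B (v i) (v j) l) =
          fun l => Q * B l * Qᵀ := by
        ext l i j
        rw [Matrix.mul_assoc]
        rfl
      rw [h2, polyMat_eq_sum, polyMat_eq_sum, Matrix.mul_sum, Matrix.sum_mul]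
      exact Finset.sum_congr rfl fun l _ => by simp [Matrix.map_mul, C']
    rw [h1]
    have h3 : C'.mapMatrix P = (Q.map C').submatrix id e := rfl
    have h4 : C'.mapMatrix Pᵀ = (Qᵀ.map C').submatrix e id := rfl
    rw [h3, h4, submatrix_mul_equiv, submatrix_mul_equiv, submatrix_id_id]
  rw [h, det_mul, det_mul, det_submatrix_equiv_self, ← RingHom.map_det, ← RingHom.map_det,
    det_transpose]
  ring

theorem NonsingularOver.of_sq_eq {k L : Type*} [Field k] [Field L] [Algebra k L]
    {f g : MvPolynomial (Fin 3) k} (hf : NonsingularOver L f) {c : k} (hc : c ≠ 0)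
    (h : g ^ 2 = MvPolynomial.C c ^ 2 * f ^ 2) : NonsingularOver L g := by
  rintro v hv ⟨h0, h1⟩
  have hc' : algebraMap k L c ≠ 0 := by simpa using hc
  have key : g = MvPolynomial.C c * f ∨ g = MvPolynomial.C (-c) * f := by
    rw [← mul_pow, sq_eq_sq_iff_eq_or_eq_neg] at h
    simpa using h
  refine hf v hv ?_
  rcases key with rfl | rfl <;> simpa [hc', MvPolynomial.pderiv_C_mul] using And.intro h0 h1

/-- A product of a linear form and a `2 × 2` determinant of linear forms is singular. -/
theorem NonsingularOver.ne_mul {k L : Type*} [Field k] [Field L] [Algebra k L] [IsAlgClosed L]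
    {f : MvPolynomial (Fin 3) k} (hf : NonsingularOver L f) (m a b c d : Fin 3 → k) :
    letI lin (u : Fin 3 → k) := ∑ i, MvPolynomial.C (u i) * MvPolynomial.X i
    f ≠ lin m * (lin a * lin d - lin b * lin c) := by
  intro h
  have hlin (u : Fin 3 → k) (v : Fin 3 → L) :
      MvPolynomial.aeval v (∑ i, MvPolynomial.C (u i) * MvPolynomial.X i) =
        (algebraMap k L ∘ u) ⬝ᵥ v := by
    simp [dotProduct]
  obtain ⟨v, hv, h1, h2⟩ := exists_common_zero (algebraMap k L ∘ m) (algebraMap k L ∘ a)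
    (algebraMap k L ∘ b) (algebraMap k L ∘ c) (algebraMap k L ∘ d)
  refine hf v hv ⟨?_, fun i => ?_⟩
  · rw [h, map_mul, hlin, h1, zero_mul]
  · rw [h, Derivation.leibniz, map_add, smul_eq_mul, smul_eq_mul, map_mul (MvPolynomial.aeval v),
      map_mul (MvPolynomial.aeval v), hlin, h1,
      map_sub (MvPolynomial.aeval (R := k) v),
      map_mul (MvPolynomial.aeval v), map_mul (MvPolynomial.aeval v)]
    simp only [hlin, h2, zero_mul, add_zero]

theorem matTensor_swap {R ι : Type*} [CommRing R] [Fintype ι] {d : ℕ} {B : Fin d → Matrix ι ι R}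
    (hskew : ∀ l, (B l)ᵀ = -B l) (u w : ι → R) : matTensor B w u = -matTensor B u w := by
  ext l
  have := congrArg (fun x => u ⬝ᵥ x *ᵥ w) (hskew l)
  simp only [neg_mulVec, dotProduct_neg] at this
  rw [Pi.neg_apply, matTensor, matTensor, ← this, mulVec_transpose, dotProduct_comm u,
    ← dotProduct_mulVec]

theorem det_polyMat_fromBlocks {R n : Type*} [CommRing R] [Fintype n] [DecidableEq n] {d : ℕ}
    (M C : Fin d → Matrix n n R) :
    (polyMat fun l => fromBlocks 0 (M l) (-(M l)ᵀ) (C l)).det = (polyMat M).det ^ 2 := by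
  rw [← det_fromBlocks_zero_neg_transpose _ (polyMat C)]
  congr 1
  ext1 (i | i) (j | j) <;> simp [polyMat]

/-- If the `u i` span an isotropic half of the space, the off-diagonal Gram block is a nonsingular
determinantal representation. -/
theorem NonsingularOver.det_polyMat_of_isotropic {k L ι : Type*} [Field k] [Field L] [Algebra k L]
    [Fintype ι] [DecidableEq ι] (hcard : Fintype.card ι = 6)
    {f : MvPolynomial (Fin 3) k} (hf : NonsingularOver L f) {B : Fin 3 → Matrix ι ι k}
    (hskew : ∀ l, (B l)ᵀ = -B l) (hdet : (polyMat B).det = f ^ 2) {u w : Fin 3 → ι → k}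
    (huw : LinearIndependent k (Sum.elim u w)) (hu : ∀ i j, matTensor B (u i) (u j) = 0) :
    NonsingularOver L (polyMat fun l => of fun i j => matTensor B (u i) (w j) l).det := by
  obtain ⟨c, hc, h⟩ := det_polyMat_gram B (by simp [hcard]) _ huw
  rw [hdet] at h
  refine hf.of_sq_eq hc (.trans ?_ h)
  rw [← det_polyMat_fromBlocks _ fun l => of fun i j => matTensor B (w i) (w j) l]
  congr 2
  ext l (i | i) (j | j)
  · simp [hu]
  · simp
  · simp [matTensor_swap hskew (u j) (w i)]
  · simp

/-- Distinct isotropic subspaces of half dimension meet trivially. -/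
theorem NonsingularOver.disjoint_of_isotropic {k L ι : Type*} [Field k] [Field L] [Algebra k L]
    [IsAlgClosed L] [Fintype ι] [DecidableEq ι] (hcard : Fintype.card ι = 6)
    {f : MvPolynomial (Fin 3) k} (hf : NonsingularOver L f) {B : Fin 3 → Matrix ι ι k}
    (hskew : ∀ l, (B l)ᵀ = -B l) (hdet : (polyMat B).det = f ^ 2)
    {U W : Submodule k (ι → k)} (hU : ∀ u ∈ U, ∀ w ∈ U, matTensor B u w = 0)
    (hW : ∀ u ∈ W, ∀ w ∈ W, matTensor B u w = 0) (hUr : Module.finrank k U = 3)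
    (hWr : Module.finrank k W = 3) (hne : U ≠ W) : Disjoint U W := by
  rw [disjoint_iff]
  by_contra hbot
  have hsup {u w : ι → k} (hu : u ∈ U ⊓ W) (hw : w ∈ U ⊔ W) : matTensor B u w = 0 := by
    obtain ⟨x, hx, y, hy, rfl⟩ := Submodule.mem_sup.mp hw
    have h1 := hU u hu.1 x hx
    have h2 := hW u hu.2 y hy
    ext l
    simpa [matTensor, mulVec_add, dotProduct_add] using
      congrArg₂ (· + ·) (congrFun h1 l) (congrFun h2 l)
  have hsum := Submodule.finrank_sup_add_finrank_inf_eq U W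
  have hpos : Module.finrank k ↥(U ⊓ W) ≠ 0 := by rwa [Ne, Submodule.finrank_eq_zero]
  have hlt : Module.finrank k ↥(U ⊓ W) < 3 := by
    rw [← hUr]
    refine Submodule.finrank_lt_finrank_of_lt (lt_of_le_of_ne inf_le_left fun h => hne ?_)
    exact Submodule.eq_of_le_of_finrank_eq (inf_eq_left.mp h) (hUr.trans hWr.symm)
  have htop : Module.finrank k (⊤ : Submodule k (ι → k)) = 6 := by simp [hcard]
  have gram (v : Fin 6 → ι → k) (hv : LinearIndependent k v) (h0 : v 0 ∈ U) (h1 : v 1 ∈ U)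
      (h2 : v 2 ∈ U) : NonsingularOver L (polyMat fun l => of fun i j : Fin 3 =>
        matTensor B (![v 0, v 1, v 2] i) (![v 3, v 4, v 5] j) l).det := by
    refine hf.det_polyMat_of_isotropic hcard hskew hdet ?_ fun i j => hU _ ?_ _ ?_
    · have : Sum.elim ![v 0, v 1, v 2] ![v 3, v 4, v 5] = v ∘ finSumFinEquiv (m := 3) (n := 3) := by
        ext1 (i | i) <;> fin_cases i <;> rfl
      exact this ▸ hv.comp _ finSumFinEquiv.injective
    · fin_cases i <;> assumption
    · fin_cases j <;> assumption
  obtain h | h : Module.finrank k ↥(U ⊓ W) = 1 ∨ Module.finrank k ↥(U ⊓ W) = 2 := by omega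
  · obtain ⟨v, hv, hm⟩ := exists_linearIndependent_mem 6 ![U ⊓ W, U, U, U ⊔ W, U ⊔ W, ⊤] (by
      intro i
      fin_cases i
      exacts [show 0 < Module.finrank k ↥(U ⊓ W) by omega,
        show 1 < Module.finrank k U by omega,
        show 2 < Module.finrank k U by omega,
        show 3 < Module.finrank k ↥(U ⊔ W) by omega,
        show 4 < Module.finrank k ↥(U ⊔ W) by omega,
        show 5 < Module.finrank k (⊤ : Submodule k (ι → k)) by omega])
    have m0 : v 0 ∈ U ⊓ W := hm 0
    have e0 : matTensor B (v 0) (v 3) = 0 := hsup m0 (hm 3)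
    have e1 : matTensor B (v 0) (v 4) = 0 := hsup m0 (hm 4)
    let N (i j : Fin 6) (l : Fin 3) : k := matTensor B (v i) (v j) l
    refine (gram v hv m0.1 (hm 1) (hm 2)).ne_mul (N 0 5) (N 1 3) (N 1 4) (N 2 3) (N 2 4) ?_
    simp [det_fin_three, polyMat, e0, e1, N]
    ring
  · obtain ⟨v, hv, hm⟩ := exists_linearIndependent_mem 6 ![U ⊓ W, U ⊓ W, U, U ⊔ W, ⊤, ⊤] (by
      intro i
      fin_cases i
      exacts [show 0 < Module.finrank k ↥(U ⊓ W) by omega,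
        show 1 < Module.finrank k ↥(U ⊓ W) by omega,
        show 2 < Module.finrank k U by omega,
        show 3 < Module.finrank k ↥(U ⊔ W) by omega,
        show 4 < Module.finrank k (⊤ : Submodule k (ι → k)) by omega,
        show 5 < Module.finrank k (⊤ : Submodule k (ι → k)) by omega])
    have m0 : v 0 ∈ U ⊓ W := hm 0
    have m1 : v 1 ∈ U ⊓ W := hm 1
    have e0 : matTensor B (v 0) (v 3) = 0 := hsup m0 (hm 3)
    have e1 : matTensor B (v 1) (v 3) = 0 := hsup m1 (hm 3)
    let N (i j : Fin 6) (l : Fin 3) : k := matTensor B (v i) (v j) l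
    refine (gram v hv m0.1 m1.1 (hm 2)).ne_mul (N 2 3) (N 0 4) (N 0 5) (N 1 4) (N 1 5) ?_
    simp [det_fin_three, polyMat, e0, e1, N]
    ring

theorem finrank_graph {k V W : Type*} [Field k] [AddCommGroup V] [Module k V] [AddCommGroup W]
    [Module k W] (g : V →ₗ[k] W) : Module.finrank k g.graph = Module.finrank k V := by
  rw [LinearMap.graph_eq_range_prod]
  exact LinearMap.finrank_range_of_inj fun x y h => congrArg Prod.fst h

/-- The graph of `Φ` is isotropic exactly when `Φ` symmetrizes every `M l`. -/
theorem isotropic_map_graph_iff {k ι : Type*} [Field k] [Fintype ι] {B : Fin 3 → Matrix ι ι k}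
    {M : Fin 3 → Matrix (Fin 3) (Fin 3) k} (e : ((Fin 3 → k) × (Fin 3 → k)) ≃ₗ[k] (ι → k))
    (he : ∀ x y l, matTensor B (e x) (e y) l = x.1 ⬝ᵥ M l *ᵥ y.2 - y.1 ⬝ᵥ M l *ᵥ x.2)
    (Φ : Matrix (Fin 3) (Fin 3) k) :
    (∀ u ∈ Φ.toLin'.graph.map e.toLinearMap, ∀ w ∈ Φ.toLin'.graph.map e.toLinearMap,
      matTensor B u w = 0) ↔ ∀ l, (M l * Φ)ᵀ = M l * Φ := by
  have h1 (x y : Fin 3 → k) (l : Fin 3) : matTensor B (e (x, Φ *ᵥ x)) (e (y, Φ *ᵥ y)) l =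
      x ⬝ᵥ (M l * Φ) *ᵥ y - y ⬝ᵥ (M l * Φ) *ᵥ x := by
    rw [he, mulVec_mulVec, mulVec_mulVec]
  constructor
  · intro h l
    ext i j
    have h2 (x : Fin 3 → k) : e (x, Φ *ᵥ x) ∈ Φ.toLin'.graph.map e.toLinearMap :=
      ⟨(x, Φ *ᵥ x), by simp [LinearMap.mem_graph_iff], rfl⟩
    have h3 := congrFun (h _ (h2 (Pi.single j 1)) _ (h2 (Pi.single i 1))) l
    rw [h1] at h3
    simpa [sub_eq_zero] using h3
  · rintro h _ ⟨⟨x, x'⟩, hx, rfl⟩ _ ⟨⟨y, y'⟩, hy, rfl⟩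
    obtain rfl : x' = Φ *ᵥ x := hx
    obtain rfl : y' = Φ *ᵥ y := hy
    ext l
    refine (h1 x y l).trans ?_
    rw [← h, mulVec_transpose, dotProduct_comm, ← dotProduct_mulVec, h, sub_self, Pi.zero_apply]

/-- A nonzero matrix symmetrizing a nonsingular determinantal representation is invertible. -/
theorem NonsingularOver.det_ne_zero {k L : Type*} [Field k] [Field L] [Algebra k L]
    [IsAlgClosed L] {M : Fin 3 → Matrix (Fin 3) (Fin 3) k}
    (hM : NonsingularOver L (polyMat M).det) {Φ : Matrix (Fin 3) (Fin 3) k}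
    (hΦ : ∀ l, (M l * Φ)ᵀ = M l * Φ) (h0 : Φ ≠ 0) : Φ.det ≠ 0 := by
  intro hdet
  obtain ⟨x, hx, hΦx⟩ := exists_mulVec_eq_zero_iff.mpr hdet
  let e := (LinearEquiv.sumArrowLequivProdArrow (Fin 3) (Fin 3) k k).symm
  let B : Fin 3 → Matrix (Fin 3 ⊕ Fin 3) (Fin 3 ⊕ Fin 3) k :=
    fun l => fromBlocks 0 (M l) (-(M l)ᵀ) 0
  have he (x y) (l : Fin 3) :
      matTensor B (e x) (e y) l = x.1 ⬝ᵥ M l *ᵥ y.2 - y.1 ⬝ᵥ M l *ᵥ x.2 := by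
    have hz (z) : e z = Sum.elim z.1 z.2 := by ext (i | i) <;> rfl
    rw [hz, hz, matTensor, fromBlocks_mulVec]
    simp only [Sum.elim_comp_inl, Sum.elim_comp_inr, sumElim_dotProduct_sumElim, zero_mulVec,
      zero_add, add_zero, neg_mulVec, dotProduct_neg, ← sub_eq_add_neg]
    rw [mulVec_transpose, dotProduct_comm x.2, ← dotProduct_mulVec]
  have hfr (Ψ : Matrix (Fin 3) (Fin 3) k) :
      Module.finrank k (Ψ.toLin'.graph.map e.toLinearMap) = 3 := by
    rw [LinearEquiv.finrank_map_eq, finrank_graph, Module.finrank_fin_fun]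
  have hdisj := hM.disjoint_of_isotropic (by simp) (B := B)
    (fun l => by simp [B, fromBlocks_transpose, fromBlocks_neg]) (det_polyMat_fromBlocks M 0)
    ((isotropic_map_graph_iff e he Φ).mpr hΦ)
    ((isotropic_map_graph_iff e he 0).mpr (by simp)) (hfr _) (hfr _) fun h => h0 <| by
      have h1 := Submodule.map_injective_of_injective e.injective h
      ext1 i j
      have h2 : (Pi.single j 1, Φ *ᵥ Pi.single j 1) ∈ (toLin' (0 : Matrix _ _ k)).graph :=
        h1 ▸ (show _ = _ from rfl)
      simpa using congrFun ((LinearMap.mem_graph_iff _ _).mp h2) i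
  have hmem (Ψ : Matrix (Fin 3) (Fin 3) k) (hΨ : Ψ *ᵥ x = 0) :
      e (x, 0) ∈ Ψ.toLin'.graph.map e.toLinearMap := ⟨(x, 0), hΨ.symm, rfl⟩
  have := Submodule.disjoint_def.mp hdisj _ (hmem Φ hΦx) (hmem 0 (zero_mulVec x))
  rw [LinearEquiv.map_eq_zero_iff] at this
  exact hx (congrArg Prod.fst this)

theorem polyMat_map {R S ι : Type*} [CommRing R] [CommRing S] (g : R →+* S) {d : ℕ}
    (B : Fin d → Matrix ι ι R) :
    polyMat (fun l => (B l).map g) = (polyMat B).map (MvPolynomial.map g) := by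
  ext1 i j
  simp [polyMat]

theorem NonsingularOver.map {k L : Type*} [Field k] [Field L] [Algebra k L]
    {f : MvPolynomial (Fin 3) k} (hf : NonsingularOver L f) :
    NonsingularOver L (MvPolynomial.map (algebraMap k L) f) := by
  intro v hv h
  refine hf v hv ?_
  simpa [MvPolynomial.pderiv_map, MvPolynomial.aeval_map_algebraMap] using h

/-- The matrices symmetrizing a nonsingular determinantal representation form a space of dimension
at most one. -/
theorem NonsingularOver.exists_eq_smul {k L : Type*} [Field k] [Field L] [Algebra k L]
    [IsAlgClosed L] {M : Fin 3 → Matrix (Fin 3) (Fin 3) k}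
    (hM : NonsingularOver L (polyMat M).det) {Φ Ψ : Matrix (Fin 3) (Fin 3) k}
    (hΦ : ∀ l, (M l * Φ)ᵀ = M l * Φ) (hΨ : ∀ l, (M l * Ψ)ᵀ = M l * Ψ) (h0 : Φ ≠ 0) :
    ∃ c : k, c • Φ = Ψ := by
  let g := algebraMap k L
  have hML : NonsingularOver L (polyMat fun l => (M l).map g).det := by
    have := hM.map
    rw [RingHom.map_det] at this
    rwa [polyMat_map]
  have hsym {A : Matrix (Fin 3) (Fin 3) k} (hA : ∀ l, (M l * A)ᵀ = M l * A) (l : Fin 3) :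
      ((M l).map g * A.map g)ᵀ = (M l).map g * A.map g := by
    rw [← Matrix.map_mul, ← transpose_map, hA]
  obtain ⟨i, j, hij⟩ : ∃ i j, Φ i j ≠ 0 := by
    by_contra! h
    exact h0 (by ext i j; exact h i j)
  have hΦu : IsUnit (Φ.map g) := by
    rw [isUnit_iff_isUnit_det, isUnit_iff_ne_zero]
    have : (Φ.map g).det = g Φ.det := (RingHom.map_det g Φ).symm
    simpa [this] using hM.det_ne_zero hΦ h0
  obtain ⟨c, hc⟩ := spectrum.nonempty_of_isAlgClosed_of_finiteDimensional L
    ((Φ.map g)⁻¹ * Ψ.map g)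
  have hdet : (c • Φ.map g - Ψ.map g).det = 0 := by
    by_contra hne
    refine hc ?_
    have h1 : algebraMap L (Matrix (Fin 3) (Fin 3) L) c - (Φ.map g)⁻¹ * Ψ.map g =
        (Φ.map g)⁻¹ * (c • Φ.map g - Ψ.map g) := by
      rw [mul_sub, mul_smul_comm, nonsing_inv_mul _ ((isUnit_iff_isUnit_det _).mp hΦu),
        Algebra.algebraMap_eq_smul_one]
    rw [spectrum.mem_resolventSet_iff, h1]
    exact ((isUnit_nonsing_inv_iff).mpr hΦu).mul
      ((isUnit_iff_isUnit_det _).mpr (isUnit_iff_ne_zero.mpr hne))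
  have heq : c • Φ.map g = Ψ.map g := by
    by_contra hne
    refine hML.det_ne_zero (fun l => ?_) (sub_ne_zero.mpr hne) hdet
    rw [mul_sub, mul_smul_comm, transpose_sub, transpose_smul, hsym hΦ, hsym hΨ]
  have hentry (a b : Fin 3) : c * g (Φ a b) = g (Ψ a b) := congrFun₂ heq a b
  refine ⟨Ψ i j / Φ i j, ?_⟩
  ext a b
  apply g.injective
  have hij' : g (Φ i j) ≠ 0 := by simpa using hij
  rw [Matrix.smul_apply, smul_eq_mul, map_mul, map_div₀, ← hentry i j, ← hentry a b,
    mul_div_cancel_right₀ _ hij']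

theorem NonsingularOver.card_symmetrizers {F L : Type*} [Field F] [Fintype F] [Field L]
    [Algebra F L] [IsAlgClosed L] {M : Fin 3 → Matrix (Fin 3) (Fin 3) F}
    (hM : NonsingularOver L (polyMat M).det) :
    Nat.card {Φ : Matrix (Fin 3) (Fin 3) F // ∀ l, (M l * Φ)ᵀ = M l * Φ} = 1 ∨
    Nat.card {Φ : Matrix (Fin 3) (Fin 3) F // ∀ l, (M l * Φ)ᵀ = M l * Φ} = Fintype.card F := by
  by_cases h : ∃ Φ : Matrix (Fin 3) (Fin 3) F, (∀ l, (M l * Φ)ᵀ = M l * Φ) ∧ Φ ≠ 0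
  · obtain ⟨Φ, hΦ, h0⟩ := h
    right
    rw [← Nat.card_eq_fintype_card]
    symm
    refine Nat.card_congr (Equiv.ofBijective
      (fun c => ⟨c • Φ, fun l => by rw [mul_smul_comm, transpose_smul, hΦ]⟩) ⟨fun c d hcd => ?_, ?_⟩)
    · exact smul_left_injective F h0 (congrArg Subtype.val hcd)
    · rintro ⟨Ψ, hΨ⟩
      obtain ⟨c, rfl⟩ := hM.exists_eq_smul hΦ hΨ h0
      exact ⟨c, rfl⟩
  · left
    push Not at h
    exact Nat.card_eq_one_iff_exists.mpr ⟨⟨0, by simp⟩, fun Φ => Subtype.ext (h Φ Φ.2)⟩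

theorem matTensor_vecMul {R ι κ : Type*} [CommRing R] [Fintype ι] [Fintype κ] {d : ℕ}
    (B : Fin d → Matrix ι ι R) (u w : κ → ι → R) (x y : κ → R) (l : Fin d) :
    matTensor B (x ᵥ* of u) (y ᵥ* of w) l =
      x ⬝ᵥ (of fun i j => matTensor B (u i) (w j) l) *ᵥ y := by
  have h : (of fun i j => matTensor B (u i) (w j) l) = of u * B l * (of w)ᵀ := by
    ext i j
    rw [Matrix.mul_assoc]
    rfl
  rw [h, matTensor, ← mulVec_mulVec, ← mulVec_mulVec, mulVec_transpose, ← dotProduct_mulVec]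

theorem NonsingularOver.card_isotropic {F L ι : Type*} [Field F] [Fintype F] [Field L]
    [Algebra F L] [IsAlgClosed L] [Fintype ι] [DecidableEq ι] (hcard : Fintype.card ι = 6)
    {f : MvPolynomial (Fin 3) F} (hf : NonsingularOver L f) {B : Fin 3 → Matrix ι ι F}
    (hskew : ∀ l, (B l)ᵀ = -B l) (hdet : (polyMat B).det = f ^ 2) :
    Nat.card {U : Submodule F (ι → F) //
      (∀ u ∈ U, ∀ w ∈ U, matTensor B u w = 0) ∧ Module.finrank F U = 3}
        ∈ ({0, 1, 2, Fintype.card F + 1} : Set ℕ) := by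
  by_cases hsub : Subsingleton {U : Submodule F (ι → F) //
      (∀ u ∈ U, ∀ w ∈ U, matTensor B u w = 0) ∧ Module.finrank F U = 3}
  · have := Finite.card_le_one_iff_subsingleton.mpr hsub
    interval_cases Nat.card {U : Submodule F (ι → F) //
      (∀ u ∈ U, ∀ w ∈ U, matTensor B u w = 0) ∧ Module.finrank F U = 3} <;> simp
  rw [not_subsingleton_iff_nontrivial] at hsub
  obtain ⟨⟨U, hU, hUr⟩, ⟨W, hW, hWr⟩, hne⟩ := hsub.exists_pair_ne
  replace hne : U ≠ W := fun h => hne (Subtype.ext h)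
  have hdisj := hf.disjoint_of_isotropic hcard hskew hdet hU hW hUr hWr hne
  have hcompl : IsCompl U W :=
    (Submodule.isCompl_iff_disjoint U W (by simp [hUr, hWr, hcard])).mpr hdisj
  let bU := Module.finBasisOfFinrankEq F U hUr
  let bW := Module.finBasisOfFinrankEq F W hWr
  let u (i : Fin 3) : ι → F := bU i
  let w (i : Fin 3) : ι → F := bW i
  let M (l : Fin 3) : Matrix (Fin 3) (Fin 3) F := of fun i j => matTensor B (u i) (w j) l
  have hM : NonsingularOver L (polyMat M).det := by
    refine hf.det_polyMat_of_isotropic hcard hskew hdet (LinearIndependent.sum_type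
      (bU.linearIndependent.map' U.subtype U.ker_subtype)
      (bW.linearIndependent.map' W.subtype W.ker_subtype) (hdisj.mono ?_ ?_))
      fun i j => hU _ (bU i).2 _ (bU j).2
    · exact Submodule.span_le.mpr (by rintro _ ⟨i, rfl⟩; exact (bU i).2)
    · exact Submodule.span_le.mpr (by rintro _ ⟨i, rfl⟩; exact (bW i).2)
  let e : ((Fin 3 → F) × (Fin 3 → F)) ≃ₗ[F] (ι → F) :=
    (bU.equivFun.symm.prodCongr bW.equivFun.symm).trans (U.prodEquivOfIsCompl W hcompl)
  have hmemW (z) : e z ∈ W ↔ z.1 = 0 := by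
    rw [← Submodule.prodEquivOfIsCompl_symm_apply_fst_eq_zero _ _ hcompl]
    simp [e, -Module.Basis.equivFun_symm_apply]
  have he (x y l) : matTensor B (e x) (e y) l = x.1 ⬝ᵥ M l *ᵥ y.2 - y.1 ⬝ᵥ M l *ᵥ x.2 := by
    have hsum (z) : e z = z.1 ᵥ* of u + z.2 ᵥ* of w := by
      simp only [e, Module.Basis.equivFun_symm_apply, vecMul_eq_sum, LinearEquiv.trans_apply,
        LinearEquiv.prodCongr_apply, Submodule.coe_prodEquivOfIsCompl', Submodule.coe_sum,
        Submodule.coe_smul]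
      rfl
    have hmu (z : Fin 3 → F) : z ᵥ* of u ∈ U := by
      rw [vecMul_eq_sum]
      exact U.sum_mem fun i _ => U.smul_mem _ (bU i).2
    have hmw (z : Fin 3 → F) : z ᵥ* of w ∈ W := by
      rw [vecMul_eq_sum]
      exact W.sum_mem fun i _ => W.smul_mem _ (bW i).2
    have hadd (a b c d : ι → F) : matTensor B (a + b) (c + d) l = matTensor B a c l +
        matTensor B b d l + matTensor B a d l + matTensor B b c l := by
      simp only [matTensor, mulVec_add, dotProduct_add, add_dotProduct]
      ring
    rw [hsum, hsum, hadd, hU _ (hmu _) _ (hmu _), hW _ (hmw _) _ (hmw _),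
      matTensor_swap hskew _ (x.2 ᵥ* of w), Pi.neg_apply, matTensor_vecMul, matTensor_vecMul]
    simp [M, sub_eq_add_neg]
  have hfr (Φ : Matrix (Fin 3) (Fin 3) F) :
      Module.finrank F (Φ.toLin'.graph.map e.toLinearMap) = 3 := by
    rw [LinearEquiv.finrank_map_eq, finrank_graph, Module.finrank_fin_fun]
  have hcongr : Nat.card (Option {Φ : Matrix (Fin 3) (Fin 3) F // ∀ l, (M l * Φ)ᵀ = M l * Φ}) =
      Nat.card {U : Submodule F (ι → F) //
        (∀ u ∈ U, ∀ w ∈ U, matTensor B u w = 0) ∧ Module.finrank F U = 3} := by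
    have hgraph (Φ : Matrix (Fin 3) (Fin 3) F) : Φ.toLin'.graph.map e.toLinearMap ≠ W := by
      intro h
      have : e (Pi.single 0 1, Φ *ᵥ Pi.single 0 1) ∈ W := h ▸ ⟨_, rfl, rfl⟩
      simpa using (hmemW _).mp this
    refine Nat.card_congr (Equiv.ofBijective (fun o => o.elim ⟨W, hW, hWr⟩ fun Φ =>
      ⟨_, (isotropic_map_graph_iff e he Φ.1).mpr Φ.2, hfr Φ.1⟩) ⟨?_, ?_⟩)
    · rintro (_ | Φ) (_ | Ψ) h
      · rfl
      · exact absurd (congrArg Subtype.val h).symm (hgraph Ψ)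
      · exact absurd (congrArg Subtype.val h) (hgraph Φ)
      · have h1 := Submodule.map_injective_of_injective e.injective (congrArg Subtype.val h)
        refine congrArg some (Subtype.ext (toLin'.injective ?_))
        refine LinearMap.ext fun x => ?_
        have h2 : (x, toLin' Φ.1 x) ∈ (toLin' Ψ.1).graph := h1 ▸ (show _ = _ from rfl)
        exact h2
    · rintro ⟨T, hT, hTr⟩
      by_cases hTW : T = W
      · subst hTW
        exact ⟨none, rfl⟩
      have hd := hf.disjoint_of_isotropic hcard hskew hdet hT hW hTr hWr hTW
      let G := T.comap e.toLinearMap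
      have hTG : G.map e.toLinearMap = T := Submodule.map_comap_eq_of_surjective e.surjective T
      have hinj : Function.Injective (LinearMap.fst F _ _ ∘ₗ G.subtype) := by
        rw [← LinearMap.ker_eq_bot, LinearMap.ker_eq_bot']
        rintro ⟨z, hz⟩ hz0
        have := Submodule.disjoint_def.mp hd _ hz ((hmemW z).mpr hz0)
        exact Subtype.ext (e.map_eq_zero_iff.mp this)
      have hG : Module.finrank F G = Module.finrank F (Fin 3 → F) := by
        rw [← LinearEquiv.finrank_map_eq e G, hTG, hTr, Module.finrank_fin_fun]
      obtain ⟨g, hg⟩ := Submodule.exists_eq_graph (G := G)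
        ⟨hinj, (LinearMap.injective_iff_surjective_of_finrank_eq_finrank hG).mp hinj⟩
      have hmap : (toLin' (LinearMap.toMatrix' g)).graph.map e.toLinearMap = T := by
        rw [toLin'_toMatrix', ← hg, hTG]
      exact ⟨some ⟨LinearMap.toMatrix' g, (isotropic_map_graph_iff e he _).mp (hmap.symm ▸ hT)⟩,
        Subtype.ext hmap⟩
  rw [← hcongr, Finite.card_option]
  rcases hM.card_symmetrizers with h | h <;> rw [h] <;> simp

theorem isHomogeneous_det_polyMat {R ι : Type*} [CommRing R] [Fintype ι] [DecidableEq ι] {d : ℕ}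
    (B : Fin d → Matrix ι ι R) : (polyMat B).det.IsHomogeneous (Fintype.card ι) := by
  rw [det_apply']
  refine MvPolynomial.IsHomogeneous.sum _ _ _ fun σ _ => ?_
  have h1 : (∏ i, polyMat B (σ i) i).IsHomogeneous (∑ _i : ι, 1) :=
    MvPolynomial.IsHomogeneous.prod _ _ _ fun i _ => by
      rw [polyMat, of_apply]
      refine MvPolynomial.IsHomogeneous.sum _ _ _ fun l _ => ?_
      simpa only [zero_add] using
        (MvPolynomial.isHomogeneous_C _ _).mul (MvPolynomial.isHomogeneous_X R l)
  have h2 := (MvPolynomial.isHomogeneous_C (Fin d) (((Equiv.Perm.sign σ : ℤˣ) : ℤ) : R)).mul h1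
  simpa using h2

/-- Let `F` be a finite field of odd characteristic with `q` elements and
`t : V × V → T` an alternating `F`-tensor, represented by the matrix of linear forms `B` in
three variables, with `det(B) = f²` for a smooth homogeneous cubic `f` (i.e. `Pf(t) = 0`
defines an elliptic curve in `P²_F`).  Then `dim_F V = 6`, `dim_F T = 3`, and the number of
totally isotropic subspaces of dimension `(1/2)·dim_F V` lies in `{0, 1, 2, q+1}`. -/
theorem statement10 {F : Type*} [Field F] [Fintype F] (p : ℕ) [CharP F p] (hodd : Odd p)
    {ι : Type*} [Fintype ι] [DecidableEq ι]
    (B : Fin 3 → Matrix ι ι F)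
    (hskew : ∀ k, (B k)ᵀ = -(B k))
    (halt : ∀ u, matTensor B u u = 0)
    (f : MvPolynomial (Fin 3) F) (hsmooth : SmoothCubic f)
    (hdet : (polyMat B).det = f ^ 2) :
    Module.finrank F (ι → F) = 6 ∧ Module.finrank F (Fin 3 → F) = 3 ∧
      Nat.card {U : Submodule F (ι → F) //
          (∀ u ∈ U, ∀ w ∈ U, matTensor B u w = 0) ∧
          2 * Module.finrank F U = Module.finrank F (ι → F)}
        ∈ ({0, 1, 2, Fintype.card F + 1} : Set ℕ) := by
  have hf : NonsingularOver (AlgebraicClosure F) f := hsmooth.2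
  have hf0 : f ≠ 0 := by
    rintro rfl
    exact hf 1 one_ne_zero (by simp)
  have hcard : Fintype.card ι = 6 := by
    refine (isHomogeneous_det_polyMat B).inj_right ?_ (hdet ▸ pow_ne_zero 2 hf0)
    rw [hdet]
    exact hsmooth.1.pow 2
  rw [Module.finrank_fintype_fun_eq_card, hcard]
  refine ⟨rfl, Module.finrank_fin_fun F, ?_⟩
  have h (n : ℕ) : 2 * n = 6 ↔ n = 3 := by omega
  simp only [h]
  exact hf.card_isotropic hcard hskew hdet
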